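/- arXiv:2104.06172 — 4 statements merged into one kernel-verified Lean document; each statement's English description precedes it below -/
import Mathlib

section
/- Let α be a CNF formula over variables x_1,…,x_{n−1}, and define the Boolean classifier ρ over {0,1}^n by ρ(x) = 1 iff α(x_1,…,x_{n−1}) = 1 or x_1 = x_2 = … = x_n = 1. Then ρ(1,…,1) = 1, and α is satisfiable if and only if there exists an instance x ∈ {0,1}^n with ρ(x) = 1 whose number of coordinates equal to 1 is strictly less than n (equivalently, the all-ones instance is a minimum-cardinality explanation of itself given ρ if and only if α is unsatisfiable). -/
/-- A literal is a variable together with a polarity (`true` for `x_i`,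
`false` for `¬x_i`); a clause is a disjunction of literals. -/
abbrev Clause (n : ℕ) := List (Fin n × Bool)

/-- A CNF formula is a conjunction of clauses. -/
abbrev CNF (n : ℕ) := List (Clause n)

/-- A clause evaluates to `true` on `x` iff some of its literals is satisfied by `x`. -/
def Clause.eval {n : ℕ} (δ : Clause n) (x : Fin n → Bool) : Bool :=
  δ.any fun l => x l.1 == l.2

/-- A CNF formula evaluates to `true` on `x` iff all of its clauses do. -/
def CNF.eval {n : ℕ} (α : CNF n) (x : Fin n → Bool) : Bool :=
  α.all fun δ => Clause.eval δ x

/-- A CNF formula is satisfiable if some instance evaluates it to `true`. -/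
def CNF.Satisfiable {n : ℕ} (α : CNF n) : Prop := ∃ x, CNF.eval α x = true

theorem stmt2 (m : ℕ) (α : CNF m)
    (ρ : (Fin (m + 1) → Bool) → Bool)
    (hρ : ∀ x, ρ x =
      (CNF.eval α (fun i => x i.castSucc) || decide (∀ i, x i = true))) :
    ρ (fun _ => true) = true ∧
      (α.Satisfiable ↔
        ∃ x, ρ x = true ∧
          (Finset.univ.filter fun i => x i = true).card < m + 1) := by
  refine ⟨by simp [hρ], ?_, ?_⟩
  · rintro ⟨y, hy⟩
    refine ⟨Fin.snoc (α := fun _ => Bool) y false, by simp [hρ, hy], ?_⟩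
    have h := Finset.card_lt_univ_of_notMem (x := Fin.last m)
      (s := Finset.univ.filter fun i => Fin.snoc (α := fun _ => Bool) y false i = true) (by simp)
    simpa using h
  · rintro ⟨x, hx, hcard⟩
    rw [hρ, Bool.or_eq_true, decide_eq_true_eq] at hx
    rcases hx with hx | hx
    · exact ⟨_, hx⟩
    · simp [hx] at hcard
end

section
/- Let α be a CNF formula over variables x_1,…,x_{n−1}, and define the Boolean classifier ρ over {0,1}^n by ρ(x) = 1 iff α(x_1,…,x_{n−1}) = 1 and at least one coordinate x_i (1 ≤ i ≤ n) equals 0. Then ρ(1,…,1) = 0, and α is satisfiable if and only if there exists an instance x ∈ {0,1}^n with ρ(x) = 1 (equivalently, α is unsatisfiable if and only if every instance of {0,1}^n is a negative instance of ρ, i.e., the empty partial assignment is a prime implicant explanation of the all-ones instance given ρ, and no counterfactual explanation of the all-ones instance exists). -/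
theorem stmt3 (m : ℕ) (α : CNF m)
    (ρ : (Fin (m + 1) → Bool) → Bool)
    (hρ : ∀ x, ρ x =
      (CNF.eval α (fun i => x i.castSucc) && decide (∃ i, x i = false))) :
    ρ (fun _ => true) = false ∧
      (α.Satisfiable ↔ ∃ x, ρ x = true) := by
  refine ⟨by simp [hρ], ?_, ?_⟩
  · rintro ⟨y, hy⟩
    refine ⟨Fin.snoc (α := fun _ => Bool) y false, ?_⟩
    rw [hρ, Bool.and_eq_true, decide_eq_true_eq]
    exact ⟨by simpa using hy, Fin.last m, by simp⟩
  · rintro ⟨x, hx⟩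
    rw [hρ, Bool.and_eq_true] at hx
    exact ⟨_, hx.1⟩
end

section
/- Let α be a CNF formula over variables x_1,…,x_{n−1}, and define the Boolean classifier ρ over {0,1}^n by ρ(x) = 1 iff α(x_1,…,x_{n−1}) = 1 or x_1 = x_2 = … = x_n = 1. Then α is unsatisfiable if and only if the maximal Hamming distance from the all-ones instance (1,…,1) to the set {x ∈ {0,1}^n : ρ(x) = 1} is 0; equivalently, α is satisfiable if and only if there exists x ∈ {0,1}^n with ρ(x) = 1 and x ≠ (1,…,1). -/
theorem stmt9 (m : ℕ) (α : CNF m)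
    (ρ : (Fin (m + 1) → Bool) → Bool)
    (hρ : ∀ x, ρ x =
      (CNF.eval α (fun i => x i.castSucc) || decide (∀ i, x i = true))) :
    (¬α.Satisfiable ↔
      (Finset.univ.filter fun x : Fin (m + 1) → Bool => ρ x = true).sup
        (fun x => hammingDist x (fun _ => true)) = 0) ∧
    (α.Satisfiable ↔ ∃ x, ρ x = true ∧ x ≠ (fun _ => true)) := by
  have satisfiable_iff : α.Satisfiable ↔ ∃ x, ρ x = true ∧ x ≠ (fun _ => true) := by
    constructor
    · rintro ⟨y, hy⟩
      refine ⟨Fin.snoc y false, ?_, fun h => ?_⟩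
      · simp [hρ, hy]
      · simpa using congrFun h (Fin.last m)
    · rintro ⟨x, hx, hne⟩
      rw [hρ, Bool.or_eq_true, decide_eq_true_eq] at hx
      exact ⟨_, hx.resolve_right fun h => hne (funext h)⟩
  refine ⟨?_, satisfiable_iff⟩
  rw [satisfiable_iff, ← Nat.bot_eq_zero, Finset.sup_eq_bot_iff]
  simp [hammingDist_eq_zero]
end

section
/- Let δ be a non-valid clause over variables x_1,…,x_n in which each variable occurs at most once, with |δ| literals. For x ∈ {0,1}^n let diff(δ, x) denote the number of literals of δ falsified by x minus the number of literals of δ satisfied by x, and define transl(x) ∈ {−1,1}^{2n} by placing 2x_j − 1 in coordinates 2j−1 and 2j for each j. Define the row vector a ∈ {−1,1}^{2n} by: coordinates (2j−1, 2j) equal (−1,−1) if x_j occurs positively in δ, (1,1) if x_j occurs negatively in δ, and (−1,1) if x_j does not occur in δ; and let b = −2|δ| + 1. Then for every x ∈ {0,1}^n, a · transl(x) + b = 2·diff(δ, x) − 2|δ| + 1; in particular this quantity equals 1 when x falsifies δ and is at most −3 (hence strictly negative) when x satisfies δ. -/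
/-- `diff δ x` = (number of literals of `δ` falsified by `x`)
              - (number of literals of `δ` satisfied by `x`). -/
def diff {n : ℕ} (δ : Clause n) (x : Fin n → Bool) : ℤ :=
  ((δ.countP fun l => x l.1 != l.2 : ℕ) : ℤ) -
    ((δ.countP fun l => x l.1 == l.2 : ℕ) : ℤ)

/-- The coordinates `2j-1, 2j` of `transl(x) ∈ {-1,1}^{2n}` are indexed here by the
pairs `(j, 0)` and `(j, 1)`; both carry the value `2 x_j - 1`. -/
def transl {n : ℕ} (x : Fin n → Bool) : Fin n × Fin 2 → ℤ :=
  fun p => 2 * (if x p.1 = true then 1 else 0) - 1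

theorem diff_cons {n : ℕ} (l : Fin n × Bool) (δ : Clause n) (x : Fin n → Bool) :
    diff (l :: δ) x = diff δ x + if x l.1 = l.2 then -1 else 1 := by
  by_cases h : x l.1 = l.2 <;> simp [diff, h] <;> ring

/-- In a clause without repeated variables, `diff` is the sum over all variables of the signed
contribution of the literal on that variable. -/
theorem sum_signed_eq_diff {n : ℕ} (δ : Clause n) (hnd : (δ.map Prod.fst).Nodup)
    (x : Fin n → Bool) :
    (∑ j : Fin n, if (j, true) ∈ δ then (if x j = true then (-1 : ℤ) else 1)
      else if (j, false) ∈ δ then (if x j = true then 1 else -1) else 0) = diff δ x := by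
  induction δ with
  | nil => simp [diff]
  | cons l δ ih =>
    rw [List.map_cons, List.nodup_cons] at hnd
    rw [diff_cons, ← ih hnd.2,
      ← Fintype.sum_ite_eq' l.1 (fun _ => if x l.1 = l.2 then (-1 : ℤ) else 1),
      ← Finset.sum_add_distrib]
    refine Finset.sum_congr rfl fun j _ => ?_
    obtain ⟨i, s⟩ := l
    have hmem : ∀ r, (i, r) ∉ δ := fun r hr => hnd.1 (List.mem_map.2 ⟨(i, r), hr, rfl⟩)
    by_cases hj : j = i
    · subst hj
      cases s <;> cases x j <;> simp [hmem]
    · simp [hj]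

theorem countP_falsified_add_countP_satisfied {n : ℕ} (δ : Clause n) (x : Fin n → Bool) :
    (δ.countP fun l => x l.1 != l.2) + (δ.countP fun l => x l.1 == l.2) = δ.length := by
  rw [add_comm, List.length_eq_countP_add_countP (fun l => x l.1 == l.2)]
  congr 2
  simp [bne, Bool.beq_eq_decide_eq]

theorem diff_eq_length_sub {n : ℕ} (δ : Clause n) (x : Fin n → Bool) :
    diff δ x = δ.length - 2 * ((δ.countP fun l => x l.1 == l.2 : ℕ) : ℤ) := by
  have := countP_falsified_add_countP_satisfied δ x
  unfold diff
  lia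

theorem stmt15 (n : ℕ) (δ : Clause n)
    (hnv : ∃ x, Clause.eval δ x = false)
    (hnd : (δ.map Prod.fst).Nodup)
    (a : Fin n × Fin 2 → ℤ)
    (ha : ∀ p, a p =
      if (p.1, true) ∈ δ then -1
      else if (p.1, false) ∈ δ then 1
      else if p.2 = 0 then -1 else 1)
    (b : ℤ) (hb : b = -2 * (δ.length : ℤ) + 1)
    (x : Fin n → Bool) :
    (∑ p : Fin n × Fin 2, a p * transl x p) + b =
        2 * diff δ x - 2 * (δ.length : ℤ) + 1 ∧
    (Clause.eval δ x = false → (∑ p : Fin n × Fin 2, a p * transl x p) + b = 1) ∧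
    (Clause.eval δ x = true → (∑ p : Fin n × Fin 2, a p * transl x p) + b ≤ -3) := by
  have hsum : ∑ p : Fin n × Fin 2, a p * transl x p = 2 * diff δ x := by
    rw [← sum_signed_eq_diff δ hnd x, Fintype.sum_prod_type, Finset.mul_sum]
    refine Finset.sum_congr rfl fun j _ => ?_
    simp only [Fin.sum_univ_two, ha, transl]
    split_ifs <;> simp_all
  rw [hsum, hb, diff_eq_length_sub]
  refine ⟨by ring, fun h => ?_, fun h => ?_⟩
  · have : (δ.countP fun l => x l.1 == l.2) = 0 := by
      simpa [Clause.eval, List.countP_eq_zero] using h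
    lia
  · have : 0 < δ.countP fun l => x l.1 == l.2 := by
      simpa [Clause.eval, List.countP_pos_iff] using h
    lia
end
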